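/- arXiv:1810.00442 — 2 statements merged into one kernel-verified Lean document; each statement's English description precedes it below -/
import Mathlib

section
/- Two local functionals agree for all field configurations iff their integrands differ by a total divergence: ∫ f̃|_s d^n x = ∫ g̃|_s d^n x for all compactly supported sections φ(x) if and only if f̃ = g̃ + ∂_μ j̃^μ for some local functions j̃^μ, which in turn holds iff δ(f̃ − g̃)/δφ^i = 0 for all i. -/
open MvPolynomial

abbrev JetVar (ι : Type) (n : ℕ) : Type := (ι × Multiset (Fin n)) ⊕ Fin n

abbrev LocalFn (ι : Type) (n : ℕ) : Type := MvPolynomial (JetVar ι n) ℝ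

variable {ι : Type} {n : ℕ} [DecidableEq ι]

noncomputable def tD (ν : Fin n) (f : LocalFn ι n) : LocalFn ι n :=
  pderiv (Sum.inr ν) f +
    ∑ v ∈ f.vars,
      (match v with
      | Sum.inl (i, μ) => X (Sum.inl (i, ν ::ₘ μ)) * pderiv (Sum.inl (i, μ)) f
      | Sum.inr _ => 0 : LocalFn ι n)

noncomputable def tDm (μ : Multiset (Fin n)) (f : LocalFn ι n) : LocalFn ι n :=
  (μ.sort (· ≤ ·)).foldr tD f

noncomputable def EL (i : ι) (f : LocalFn ι n) : LocalFn ι n :=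
  ∑ v ∈ f.vars,
    (match v with
    | Sum.inl (j, μ) =>
        if j = i then ((-1 : ℝ) ^ Multiset.card μ) • tDm μ (pderiv (Sum.inl (j, μ)) f)
        else 0
    | Sum.inr _ => 0 : LocalFn ι n)

noncomputable def evQ (Q : ι → LocalFn ι n) (f : LocalFn ι n) : LocalFn ι n :=
  ∑ v ∈ f.vars,
    (match v with
    | Sum.inl (i, μ) => tDm μ (Q i) * pderiv (Sum.inl (i, μ)) f
    | Sum.inr _ => 0 : LocalFn ι n)

/-- evaluation at the zero section: all jet variables φ^i_{(μ)} set to 0. -/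
noncomputable def zeroSection {ι : Type} {n : ℕ} (f : LocalFn ι n) : LocalFn ι n :=
  aeval (fun v : JetVar ι n =>
    match v with
    | Sum.inl _ => 0
    | Sum.inr ν => X (Sum.inr ν)) f

/-- Partial derivative of a function on ℝⁿ along the ν-th coordinate. -/
noncomputable def pdF {n : ℕ} (ν : Fin n) (g : (Fin n → ℝ) → ℝ) : (Fin n → ℝ) → ℝ :=
  fun x => fderiv ℝ g x (Pi.single ν 1)

/-- Iterated partial derivatives along the multi-index (μ). -/
noncomputable def pdm {n : ℕ} (μ : Multiset (Fin n)) (g : (Fin n → ℝ) → ℝ) :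
    (Fin n → ℝ) → ℝ :=
  (μ.sort (· ≤ ·)).foldr pdF g

/-- Evaluation f|_s of a local function at a section φ^i(x): the jet variable
φ^i_{(μ)} is replaced by the corresponding derivative of φ^i at x. -/
noncomputable def evalSection {ι : Type} {n : ℕ} (φ : ι → (Fin n → ℝ) → ℝ)
    (f : LocalFn ι n) (x : Fin n → ℝ) : ℝ :=
  MvPolynomial.eval (fun v : JetVar ι n =>
    match v with
    | Sum.inl (i, μ) => pdm μ (φ i) x
    | Sum.inr ν => x ν) f

theorem derivation_eq_sum_vars {σ : Type*}
    (D : Derivation ℝ (MvPolynomial σ ℝ) (MvPolynomial σ ℝ)) (f : MvPolynomial σ ℝ) :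
    D f = ∑ v ∈ f.vars, D (X v) * pderiv v f := by
  classical
  have hsum : ∀ g : MvPolynomial σ ℝ, (∑ v ∈ f.vars, D (X v) • pderiv (R := ℝ) v) g =
      ∑ v ∈ f.vars, D (X v) * pderiv v g := by
    intro g
    change Derivation.coeFnAddMonoidHom _ g = _
    rw [map_sum, Finset.sum_apply]
    rfl
  rw [← hsum]
  refine derivation_eq_of_forall_mem_vars fun w hw => ?_
  rw [hsum, Finset.sum_eq_single w] <;> simp +contextual [hw]

/-- The total derivative, as a derivation of the algebra of local functions. -/
noncomputable def totalDerivation {ι : Type} {n : ℕ} (ν : Fin n) :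
    Derivation ℝ (LocalFn ι n) (LocalFn ι n) :=
  mkDerivation ℝ fun v : JetVar ι n =>
    match v with
    | Sum.inl (i, μ) => X (Sum.inl (i, ν ::ₘ μ))
    | Sum.inr κ => if κ = ν then 1 else 0

@[simp]
theorem totalDerivation_X_inl {ι : Type} {n : ℕ} (ν : Fin n) (i : ι) (μ : Multiset (Fin n)) :
    totalDerivation ν (X (Sum.inl (i, μ)) : LocalFn ι n) = X (Sum.inl (i, ν ::ₘ μ)) := by
  simp [totalDerivation]

@[simp]
theorem totalDerivation_X_inr {ι : Type} {n : ℕ} (ν κ : Fin n) :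
    totalDerivation ν (X (Sum.inr κ) : LocalFn ι n) = if κ = ν then 1 else 0 := by
  simp [totalDerivation]

theorem tD_eq_totalDerivation {ι : Type} {n : ℕ} (ν : Fin n) (f : LocalFn ι n) :
    tD ν f = totalDerivation ν f := by
  classical
  rw [derivation_eq_sum_vars, tD]
  have key : pderiv (Sum.inr ν) f =
      ∑ v ∈ f.vars, if v = Sum.inr ν then pderiv (Sum.inr ν) f else 0 := by
    by_cases h : Sum.inr ν ∈ f.vars
    · simp [h]
    · rw [pderiv_eq_zero_of_notMem_vars h]; simp
  rw [key, ← Finset.sum_add_distrib]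
  refine Finset.sum_congr rfl ?_
  rintro (⟨i, μ⟩ | κ) _
  · simp
  · by_cases h : κ = ν
    · subst h; simp
    · simp [h]

theorem totalDerivation_comm {ι : Type} {n : ℕ} (ν κ : Fin n) (f : LocalFn ι n) :
    totalDerivation ν (totalDerivation κ f) = totalDerivation κ (totalDerivation ν f) := by
  have h : ⁅(totalDerivation ν : Derivation ℝ (LocalFn ι n) (LocalFn ι n)),
      totalDerivation (ι := ι) κ⁆ = 0 := by
    refine derivation_ext ?_
    rintro (⟨i, μ⟩ | τ)
    · simp [Derivation.commutator_apply, Multiset.cons_swap]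
    · simp only [Derivation.commutator_apply, totalDerivation_X_inr, apply_ite, map_zero,
        Derivation.map_one_eq_zero]
      simp
  have := congrArg (fun D : Derivation ℝ (LocalFn ι n) (LocalFn ι n) => D f) h
  simpa [Derivation.commutator_apply, sub_eq_zero] using this

instance {ι : Type} {n : ℕ} : LeftCommutative (tD : Fin n → LocalFn ι n → LocalFn ι n) :=
  ⟨fun a b f => by simpa only [tD_eq_totalDerivation] using totalDerivation_comm a b f⟩

theorem tDm_eq_foldr {ι : Type} {n : ℕ} (μ : Multiset (Fin n)) (f : LocalFn ι n) :
    tDm μ f = μ.foldr tD f := by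
  conv_rhs => rw [← Multiset.sort_eq μ (· ≤ ·)]
  rw [Multiset.coe_foldr]
  rfl

@[simp]
theorem tDm_zero {ι : Type} {n : ℕ} (f : LocalFn ι n) : tDm 0 f = f := by
  simp [tDm_eq_foldr]

theorem tDm_cons {ι : Type} {n : ℕ} (ν : Fin n) (μ : Multiset (Fin n)) (f : LocalFn ι n) :
    tDm (ν ::ₘ μ) f = totalDerivation ν (tDm μ f) := by
  simp [tDm_eq_foldr, tD_eq_totalDerivation]

theorem tDm_cons' {ι : Type} {n : ℕ} (ν : Fin n) (μ : Multiset (Fin n)) (f : LocalFn ι n) :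
    tDm (ν ::ₘ μ) f = tDm μ (totalDerivation ν f) := by
  induction μ using Multiset.induction_on with
  | empty => rw [tDm_cons, tDm_zero, tDm_zero]
  | cons κ μ ih =>
    rw [tDm_cons, tDm_cons, tDm_cons, totalDerivation_comm, ← tDm_cons, ih]

theorem tDm_X {ι : Type} {n : ℕ} (i : ι) (μ : Multiset (Fin n)) :
    tDm μ (X (Sum.inl (i, 0)) : LocalFn ι n) = X (Sum.inl (i, μ)) := by
  induction μ using Multiset.induction_on with
  | empty => simp
  | cons κ μ ih => simp [tDm_cons, ih]

/-- The subspace of total divergences. -/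
noncomputable def totalDivergences (ι : Type) (n : ℕ) : Submodule ℝ (LocalFn ι n) :=
  LinearMap.range (∑ ν : Fin n,
    (totalDerivation (ι := ι) ν).toLinearMap ∘ₗ LinearMap.proj (φ := fun _ => LocalFn ι n) ν)

theorem mem_totalDivergences {ι : Type} {n : ℕ} {f : LocalFn ι n} :
    f ∈ totalDivergences ι n ↔ ∃ j : Fin n → LocalFn ι n, f = ∑ ν, totalDerivation ν (j ν) := by
  simp [totalDivergences, eq_comm]

theorem totalDerivation_mem_totalDivergences {ι : Type} {n : ℕ} (ν : Fin n) (f : LocalFn ι n) :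
    totalDerivation ν f ∈ totalDivergences ι n := by
  classical
  refine mem_totalDivergences.2 ⟨Pi.single ν f, ?_⟩
  rw [Finset.sum_eq_single ν] <;> simp +contextual

theorem tDm_mul_sub_mem_totalDivergences {ι : Type} {n : ℕ} (μ : Multiset (Fin n))
    (a b : LocalFn ι n) :
    tDm μ a * b - a * ((-1 : ℝ) ^ Multiset.card μ • tDm μ b) ∈ totalDivergences ι n := by
  induction μ using Multiset.induction_on generalizing b with
  | empty => simp
  | cons ν μ ih =>
    have h := (totalDivergences ι n).sub_mem
      (totalDerivation_mem_totalDivergences ν (tDm μ a * b)) (ih (totalDerivation ν b))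
    convert h using 1
    rw [tDm_cons, tDm_cons' ν μ b, Derivation.leibniz, Multiset.card_cons, pow_succ]
    simp only [smul_eq_mul, mul_neg, mul_one, neg_smul]
    ring

/-- The derivation counting the number of field factors of a local function. -/
noncomputable def fieldCount (ι : Type) (n : ℕ) :
    Derivation ℝ (LocalFn ι n) (LocalFn ι n) :=
  mkDerivation ℝ fun v : JetVar ι n => if v.isLeft then X v else 0

/-- The number of field factors in a monomial. -/
noncomputable def fieldDegree {ι : Type} {n : ℕ} (m : JetVar ι n →₀ ℕ) : ℝ :=
  ∑ v ∈ m.support, if v.isLeft then (m v : ℝ) else 0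

theorem fieldCount_monomial {ι : Type} {n : ℕ} (m : JetVar ι n →₀ ℕ) (r : ℝ) :
    fieldCount ι n (monomial m r) = fieldDegree m • monomial m r := by
  rcases eq_or_ne r 0 with rfl | hr
  · simp
  rw [derivation_eq_sum_vars, vars_monomial hr, fieldDegree, Finset.sum_smul]
  refine Finset.sum_congr rfl fun v _ => ?_
  rw [fieldCount, mkDerivation_X]
  split_ifs
  · rw [X_mul_pderiv_monomial, Nat.cast_smul_eq_nsmul]
  · simp

theorem coeff_fieldCount {ι : Type} {n : ℕ} (m : JetVar ι n →₀ ℕ) (f : LocalFn ι n) :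
    coeff m (fieldCount ι n f) = fieldDegree m * coeff m f := by
  classical
  induction f using MvPolynomial.induction_on' with
  | monomial m' r =>
    rw [fieldCount_monomial, coeff_smul, coeff_monomial, smul_eq_mul]
    split_ifs with h
    · rw [h]
    · simp
  | add p q hp hq => rw [map_add, coeff_add, coeff_add, hp, hq, mul_add]

theorem fieldCount_totalDerivation {ι : Type} {n : ℕ} (ν : Fin n) (f : LocalFn ι n) :
    fieldCount ι n (totalDerivation ν f) = totalDerivation ν (fieldCount ι n f) := by
  have h : ⁅fieldCount ι n, totalDerivation (ι := ι) ν⁆ = 0 := by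
    refine derivation_ext ?_
    rintro (⟨i, μ⟩ | τ)
    · simp [Derivation.commutator_apply, fieldCount]
    · simp only [Derivation.commutator_apply, totalDerivation_X_inr, fieldCount, mkDerivation_X]
      split_ifs <;> simp_all
  have := congrArg (fun D : Derivation ℝ (LocalFn ι n) (LocalFn ι n) => D f) h
  simpa [Derivation.commutator_apply, sub_eq_zero] using this

/-- The inverse of `fieldCount` on local functions without field-independent part. -/
noncomputable def fieldCountInv (ι : Type) (n : ℕ) : LocalFn ι n →ₗ[ℝ] LocalFn ι n :=
  (basisMonomials (JetVar ι n) ℝ).constr ℝ fun m => monomial m (fieldDegree m)⁻¹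

theorem fieldCountInv_monomial {ι : Type} {n : ℕ} (m : JetVar ι n →₀ ℕ) (r : ℝ) :
    fieldCountInv ι n (monomial m r) = (fieldDegree m)⁻¹ • monomial m r := by
  have h : (monomial m r : LocalFn ι n) = r • basisMonomials (JetVar ι n) ℝ m := by
    simp [smul_monomial]
  rw [h, map_smul, fieldCountInv, Module.Basis.constr_basis]
  simp [smul_monomial, mul_comm]

theorem coeff_fieldCountInv {ι : Type} {n : ℕ} (m : JetVar ι n →₀ ℕ) (f : LocalFn ι n) :
    coeff m (fieldCountInv ι n f) = (fieldDegree m)⁻¹ * coeff m f := by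
  classical
  induction f using MvPolynomial.induction_on' with
  | monomial m' r =>
    rw [fieldCountInv_monomial, coeff_smul, coeff_monomial, smul_eq_mul]
    split_ifs with h
    · rw [h]
    · simp
  | add p q hp hq => rw [map_add, coeff_add, coeff_add, hp, hq, mul_add]

theorem fieldCountInv_of_fieldCount_eq_smul {ι : Type} {n : ℕ} {f : LocalFn ι n} {c : ℝ}
    (h : fieldCount ι n f = c • f) : fieldCountInv ι n f = c⁻¹ • f := by
  ext m
  have hm := congrArg (coeff m) h
  rw [coeff_fieldCount, coeff_smul, smul_eq_mul] at hm
  rw [coeff_fieldCountInv, coeff_smul, smul_eq_mul]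
  rcases eq_or_ne (coeff m f) 0 with h0 | h0
  · simp [h0]
  · rw [mul_right_cancel₀ h0 hm]

theorem fieldCountInv_totalDerivation {ι : Type} {n : ℕ} (ν : Fin n) (f : LocalFn ι n) :
    fieldCountInv ι n (totalDerivation ν f) = totalDerivation ν (fieldCountInv ι n f) := by
  induction f using MvPolynomial.induction_on' with
  | monomial m r =>
    rw [fieldCountInv_monomial, Derivation.map_smul]
    apply fieldCountInv_of_fieldCount_eq_smul
    rw [fieldCount_totalDerivation, fieldCount_monomial, Derivation.map_smul]
  | add p q hp hq => simp only [map_add, hp, hq]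

theorem fieldCountInv_mem_totalDivergences {ι : Type} {n : ℕ} {f : LocalFn ι n}
    (hf : f ∈ totalDivergences ι n) : fieldCountInv ι n f ∈ totalDivergences ι n := by
  obtain ⟨j, rfl⟩ := mem_totalDivergences.1 hf
  refine mem_totalDivergences.2 ⟨fun ν => fieldCountInv ι n (j ν), ?_⟩
  simp only [map_sum, fieldCountInv_totalDerivation]

theorem zeroSection_X_inl {ι : Type} {n : ℕ} (p : ι × Multiset (Fin n)) :
    zeroSection (X (Sum.inl p) : LocalFn ι n) = 0 := by
  simp [zeroSection]

theorem zeroSection_X_inr {ι : Type} {n : ℕ} (ν : Fin n) :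
    zeroSection (X (Sum.inr ν) : LocalFn ι n) = X (Sum.inr ν) := by
  simp [zeroSection]

theorem coeff_zeroSection_of_fieldDegree_eq_zero {ι : Type} {n : ℕ} {m : JetVar ι n →₀ ℕ}
    (hm : fieldDegree m = 0) (f : LocalFn ι n) : coeff m (zeroSection f) = coeff m f := by
  classical
  induction f using MvPolynomial.induction_on' with
  | add p q hp hq =>
    rw [coeff_add, ← hp, ← hq, ← coeff_add, zeroSection, zeroSection, zeroSection, map_add]
  | monomial m' r =>
    rw [zeroSection, aeval_monomial]
    by_cases h : ∀ v ∈ m'.support, v.isLeft = false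
    · rw [monomial_eq, algebraMap_eq]
      congr 2
      refine Finset.prod_congr rfl ?_
      rintro (v | v) hv
      · simpa using h _ hv
      · rfl
    · push Not at h
      obtain ⟨v | v, hv, hl⟩ := h
      · have hz : (m'.prod fun (w : JetVar ι n) k => (match w with
            | Sum.inl _ => 0
            | Sum.inr ν => X (Sum.inr ν) : LocalFn ι n) ^ k) = 0 :=
          Finset.prod_eq_zero hv (by simpa using hv)
        rw [hz, mul_zero, coeff_zero, coeff_monomial, if_neg]
        rintro rfl
        rw [fieldDegree, Finset.sum_eq_zero_iff_of_nonneg] at hm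
        · have := hm _ hv
          simp at this hv
          exact hv this
        · intro w _
          split_ifs <;> positivity
      · simp at hl

theorem fieldCountInv_fieldCount {ι : Type} {n : ℕ} {f : LocalFn ι n} (hf : zeroSection f = 0) :
    fieldCountInv ι n (fieldCount ι n f) = f := by
  ext m
  rw [coeff_fieldCountInv, coeff_fieldCount]
  by_cases hm : fieldDegree m = 0
  · rw [← coeff_zeroSection_of_fieldDegree_eq_zero hm f, hf]
    simp
  · field_simp

theorem fieldCount_mem_totalDivergences {ι : Type} {n : ℕ} [DecidableEq ι] {f : LocalFn ι n}
    (hf : ∀ i, EL i f = 0) : fieldCount ι n f ∈ totalDivergences ι n := by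
  classical
  set I : Finset ι := f.vars.biUnion fun v => match v with
    | Sum.inl (i, _) => {i}
    | Sum.inr _ => ∅
  have hEL : fieldCount ι n f =
      fieldCount ι n f - ∑ i ∈ I, X (Sum.inl (i, 0)) * EL i f := by
    simp [hf]
  rw [hEL, derivation_eq_sum_vars]
  simp only [EL, Finset.mul_sum]
  rw [Finset.sum_comm, ← Finset.sum_sub_distrib]
  refine Submodule.sum_mem _ ?_
  rintro (⟨j, μ⟩ | κ) hv
  · have hj : j ∈ I := Finset.mem_biUnion.2 ⟨_, hv, by simp⟩
    have := tDm_mul_sub_mem_totalDivergences μ (X (Sum.inl (j, 0)))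
      (pderiv (Sum.inl (j, μ)) f)
    simpa [fieldCount, tDm_X, hj] using this
  · simp [fieldCount]

/-- A local function without field-independent part whose Euler-Lagrange derivatives vanish is a
total divergence. -/
theorem mem_totalDivergences_of_EL_eq_zero {ι : Type} {n : ℕ} [DecidableEq ι] {f : LocalFn ι n}
    (h0 : zeroSection f = 0) (hf : ∀ i, EL i f = 0) : f ∈ totalDivergences ι n := by
  rw [← fieldCountInv_fieldCount h0]
  exact fieldCountInv_mem_totalDivergences (fieldCount_mem_totalDivergences hf)

section Calculus

variable {n : ℕ} {g g' η : (Fin n → ℝ) → ℝ}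

theorem contDiff_pdF (ν : Fin n) (hg : ContDiff ℝ (⊤ : ℕ∞) g) :
    ContDiff ℝ (⊤ : ℕ∞) (pdF ν g) :=
  (hg.fderiv_right (m := (⊤ : ℕ∞)) le_rfl).clm_apply contDiff_const

theorem pdF_comm (ν κ : Fin n) (hg : ContDiff ℝ (⊤ : ℕ∞) g) :
    pdF ν (pdF κ g) = pdF κ (pdF ν g) := by
  funext x
  have hs : IsSymmSndFDerivAt ℝ g x :=
    hg.contDiffAt.isSymmSndFDerivAt (by simpa using WithTop.coe_le_coe.2 (le_top : (2 : ℕ∞) ≤ ⊤))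
  have hd : DifferentiableAt ℝ (fderiv ℝ g) x :=
    ((hg.fderiv_right (m := (⊤ : ℕ∞)) le_rfl).differentiable (by simp)) x
  have h : ∀ a b : Fin n → ℝ,
      fderiv ℝ (fun y => fderiv ℝ g y a) x b = fderiv ℝ (fderiv ℝ g) x b a := by
    intro a b
    rw [fderiv_clm_apply hd (differentiableAt_const a)]
    simp
  unfold pdF
  rw [h, h, hs]

theorem contDiff_foldr_pdF (l : List (Fin n)) (hg : ContDiff ℝ (⊤ : ℕ∞) g) :
    ContDiff ℝ (⊤ : ℕ∞) (l.foldr pdF g) := by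
  induction l with
  | nil => exact hg
  | cons ν l ih => exact contDiff_pdF ν ih

theorem foldr_pdF_perm {l l' : List (Fin n)} (h : l.Perm l') (hg : ContDiff ℝ (⊤ : ℕ∞) g) :
    l.foldr pdF g = l'.foldr pdF g := by
  induction h with
  | nil => rfl
  | cons ν _ ih => simp [ih]
  | swap ν κ l => exact pdF_comm _ _ (contDiff_foldr_pdF l hg)
  | trans _ _ ih ih' => exact ih.trans ih'

theorem contDiff_pdm (μ : Multiset (Fin n)) (hg : ContDiff ℝ (⊤ : ℕ∞) g) :
    ContDiff ℝ (⊤ : ℕ∞) (pdm μ g) :=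
  contDiff_foldr_pdF _ hg

@[simp]
theorem pdm_zero : pdm 0 g = g := by
  simp [pdm]

theorem pdm_cons (ν : Fin n) (μ : Multiset (Fin n)) (hg : ContDiff ℝ (⊤ : ℕ∞) g) :
    pdm (ν ::ₘ μ) g = pdF ν (pdm μ g) :=
  foldr_pdF_perm (l' := ν :: μ.sort (· ≤ ·))
    (Multiset.coe_eq_coe.1 (by rw [Multiset.sort_eq, ← Multiset.cons_coe, Multiset.sort_eq])) hg

theorem pdm_add_const_mul (μ : Multiset (Fin n)) (hg : ContDiff ℝ (⊤ : ℕ∞) g)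
    (hη : ContDiff ℝ (⊤ : ℕ∞) η) (c : ℝ) :
    pdm μ (fun x => g x + c * η x) = fun x => pdm μ g x + c * pdm μ η x := by
  induction μ using Multiset.induction_on with
  | empty => simp
  | cons ν μ ih =>
    have hg' := ((contDiff_pdm μ hg).differentiable (by simp))
    have hη' := ((contDiff_pdm μ hη).differentiable (by simp))
    rw [pdm_cons _ _ (hg.add (contDiff_const.mul hη)), pdm_cons _ _ hg, pdm_cons _ _ hη, ih]
    funext x
    unfold pdF
    rw [fderiv_fun_add (hg' x) ((hη' x).const_mul c), fderiv_const_mul (hη' x)]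
    simp

theorem tsupport_pdF_subset (ν : Fin n) : tsupport (pdF ν g) ⊆ tsupport g :=
  tsupport_fderiv_apply_subset ℝ _

theorem hasCompactSupport_pdF (ν : Fin n) (hg : HasCompactSupport g) :
    HasCompactSupport (pdF ν g) :=
  hg.of_isClosed_subset (isClosed_tsupport _) (tsupport_pdF_subset ν)

theorem tsupport_pdm_subset (μ : Multiset (Fin n)) : tsupport (pdm μ g) ⊆ tsupport g := by
  unfold pdm
  induction μ.sort (· ≤ ·) with
  | nil => exact subset_rfl
  | cons ν l ih => exact (tsupport_pdF_subset ν).trans ih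

theorem hasCompactSupport_pdm (μ : Multiset (Fin n)) (hg : HasCompactSupport g) :
    HasCompactSupport (pdm μ g) :=
  hg.of_isClosed_subset (isClosed_tsupport _) (tsupport_pdm_subset μ)

theorem pdm_eventuallyEq (μ : Multiset (Fin n)) {x : Fin n → ℝ} (h : g =ᶠ[nhds x] g') :
    pdm μ g =ᶠ[nhds x] pdm μ g' := by
  unfold pdm
  induction μ.sort (· ≤ ·) with
  | nil => exact h
  | cons ν l ih =>
    filter_upwards [ih.fderiv (𝕜 := ℝ)] with y hy
    simp only [List.foldr_cons, pdF, hy]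

theorem contDiff_eval {σ : Type*} {u : σ → (Fin n → ℝ) → ℝ}
    (hu : ∀ s, ContDiff ℝ (⊤ : ℕ∞) (u s)) (p : MvPolynomial σ ℝ) :
    ContDiff ℝ (⊤ : ℕ∞) fun x => eval (fun s => u s x) p := by
  induction p using MvPolynomial.induction_on with
  | C a => simpa using contDiff_const
  | add p q hp hq => simpa using hp.add hq
  | mul_X p s hp => simpa using hp.mul (hu s)

theorem pdF_eval {σ : Type*} {u : σ → (Fin n → ℝ) → ℝ} (hu : ∀ s, ContDiff ℝ (⊤ : ℕ∞) (u s))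
    {ν : Fin n} {D : Derivation ℝ (MvPolynomial σ ℝ) (MvPolynomial σ ℝ)}
    (hD : ∀ s x, pdF ν (u s) x = eval (fun s => u s x) (D (X s))) (p : MvPolynomial σ ℝ) :
    pdF ν (fun x => eval (fun s => u s x) p) = fun x => eval (fun s => u s x) (D p) := by
  have hd : ∀ q : MvPolynomial σ ℝ, Differentiable ℝ fun x => eval (fun s => u s x) q :=
    fun q => (contDiff_eval hu q).differentiable (by simp)
  induction p using MvPolynomial.induction_on with
  | C a => funext x; simp [pdF]
  | add p q hp hq =>
    funext x
    have hp' := congrFun hp x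
    have hq' := congrFun hq x
    simp only [map_add, pdF] at hp' hq' ⊢
    rw [fderiv_fun_add (hd p x) (hd q x), ← hp', ← hq']
    rfl
  | mul_X p s hp =>
    funext x
    have hp' := congrFun hp x
    have hs := hD s x
    have hus := ((hu s).differentiable (by simp)) x
    simp only [map_mul, eval_X, pdF] at hp' hs ⊢
    rw [fderiv_fun_mul (hd p x) hus, Derivation.leibniz]
    simp [hp', hs]

theorem integral_pdF_mul (ν : Fin n) (hη : ContDiff ℝ (⊤ : ℕ∞) η) (hc : HasCompactSupport η)
    (hg : ContDiff ℝ (⊤ : ℕ∞) g) :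
    ∫ x, pdF ν η x * g x = -∫ x, η x * pdF ν g x := by
  have h := integral_mul_fderiv_eq_neg_fderiv_mul_of_integrable (μ := MeasureTheory.volume)
    (f := η) (g := g) (v := Pi.single ν 1)
    (((contDiff_pdF ν hη).continuous.mul hg.continuous).integrable_of_hasCompactSupport
      (hasCompactSupport_pdF ν hc).mul_right)
    ((hη.continuous.mul (contDiff_pdF ν hg).continuous).integrable_of_hasCompactSupport
      hc.mul_right)
    ((hη.continuous.mul hg.continuous).integrable_of_hasCompactSupport hc.mul_right)
    (fun x _ => hη.differentiable (by simp) x) (fun x _ => hg.differentiable (by simp) x)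
  unfold pdF
  rw [h, neg_neg]

end Calculus

section Sections

variable {ι : Type} {n : ℕ} {φ : ι → (Fin n → ℝ) → ℝ}

/-- The jet variables, evaluated along a section. -/
noncomputable def jetFn (φ : ι → (Fin n → ℝ) → ℝ) : JetVar ι n → (Fin n → ℝ) → ℝ
  | Sum.inl (i, μ) => pdm μ (φ i)
  | Sum.inr ν => fun x => x ν

theorem evalSection_eq_eval (f : LocalFn ι n) (x : Fin n → ℝ) :
    evalSection φ f x = eval (fun v => jetFn φ v x) f := by
  unfold evalSection
  congr 2
  funext v
  rcases v with ⟨i, μ⟩ | ν <;> rfl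

theorem contDiff_jetFn (hφ : ∀ i, ContDiff ℝ (⊤ : ℕ∞) (φ i)) (v : JetVar ι n) :
    ContDiff ℝ (⊤ : ℕ∞) (jetFn φ v) := by
  rcases v with ⟨i, μ⟩ | ν
  · exact contDiff_pdm μ (hφ i)
  · exact contDiff_apply ℝ ℝ ν

theorem contDiff_evalSection (hφ : ∀ i, ContDiff ℝ (⊤ : ℕ∞) (φ i)) (f : LocalFn ι n) :
    ContDiff ℝ (⊤ : ℕ∞) (evalSection φ f) := by
  have h : evalSection φ f = fun x => eval (fun v => jetFn φ v x) f :=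
    funext (evalSection_eq_eval f)
  rw [h]
  exact contDiff_eval (contDiff_jetFn hφ) f

/-- The total derivative of a local function evaluates to the derivative of its evaluation. -/
theorem pdF_evalSection (hφ : ∀ i, ContDiff ℝ (⊤ : ℕ∞) (φ i)) (ν : Fin n) (f : LocalFn ι n) :
    pdF ν (evalSection φ f) = evalSection φ (totalDerivation ν f) := by
  have h : ∀ f, evalSection φ f = fun x => eval (fun v => jetFn φ v x) f :=
    fun f => funext (evalSection_eq_eval f)
  rw [h, h]
  refine pdF_eval (contDiff_jetFn hφ) ?_ f
  rintro (⟨i, μ⟩ | κ) x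
  · simp [jetFn, pdm_cons ν μ (hφ i)]
  · have : fderiv ℝ (fun y : Fin n → ℝ => y κ) x = ContinuousLinearMap.proj κ :=
      (ContinuousLinearMap.proj (R := ℝ) (φ := fun _ : Fin n => ℝ) κ).fderiv
    simp only [jetFn, pdF, this, totalDerivation_X_inr, ContinuousLinearMap.proj_apply,
      Pi.single_apply]
    split_ifs <;> simp

theorem hasCompactSupport_evalSection (hc : ∀ i, HasCompactSupport (φ i)) {f : LocalFn ι n}
    (hf : zeroSection f = 0) : HasCompactSupport (evalSection φ f) := by
  classical
  let k : JetVar ι n → Set (Fin n → ℝ) := Sum.elim (fun p => tsupport (φ p.1)) fun _ => ∅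
  have hkc : IsCompact (⋃ v ∈ f.vars, k v) := by
    refine f.vars.isCompact_biUnion ?_
    rintro (⟨i, μ⟩ | ν) _
    · exact hc i
    · exact isCompact_empty
  refine HasCompactSupport.intro hkc fun x hx => ?_
  have h0 : eval (fun v => jetFn φ v x) (zeroSection f) = 0 := by rw [hf, map_zero]
  rw [evalSection_eq_eval, ← h0, zeroSection, ← coe_aeval_eq_eval, RingHom.coe_coe,
    ← AlgHom.comp_apply, comp_aeval]
  refine eval₂Hom_congr' rfl ?_ rfl
  rintro (⟨i, μ⟩ | ν) hv _
  · have hxi : x ∉ tsupport (φ i) := fun hxi => hx (Set.mem_biUnion (t := k) hv hxi)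
    simp only [map_zero]
    exact image_eq_zero_of_notMem_tsupport fun h => hxi (tsupport_pdm_subset μ h)
  · simp

theorem integrable_evalSection (hφ : ∀ i, ContDiff ℝ (⊤ : ℕ∞) (φ i))
    (hc : ∀ i, HasCompactSupport (φ i)) {f : LocalFn ι n} (hf : zeroSection f = 0) :
    MeasureTheory.Integrable (evalSection φ f) :=
  (contDiff_evalSection hφ f).continuous.integrable_of_hasCompactSupport
    (hasCompactSupport_evalSection hc hf)

theorem integral_evalSection_totalDerivation (hφ : ∀ i, ContDiff ℝ (⊤ : ℕ∞) (φ i))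
    (hc : ∀ i, HasCompactSupport (φ i)) {f : LocalFn ι n} (hf : zeroSection f = 0)
    (ν : Fin n) : ∫ x, evalSection φ (totalDerivation ν f) x = 0 := by
  have h := integral_pdF_mul ν (contDiff_evalSection hφ f) (hasCompactSupport_evalSection hc hf)
    (contDiff_const (c := (1 : ℝ)))
  rw [pdF_evalSection hφ] at h
  simpa [pdF] using h

theorem zeroSection_totalDerivation (ν : Fin n) (f : LocalFn ι n) :
    zeroSection (totalDerivation ν f) = totalDerivation ν (zeroSection f) := by
  have hmul : ∀ p q : LocalFn ι n, zeroSection (p * q) = zeroSection p * zeroSection q :=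
    fun p q => map_mul _ p q
  have hadd : ∀ p q : LocalFn ι n, zeroSection (p + q) = zeroSection p + zeroSection q :=
    fun p q => map_add _ p q
  induction f using MvPolynomial.induction_on with
  | C a => simp [zeroSection, algebraMap_eq]
  | add p q hp hq => simp only [map_add, hadd, hp, hq]
  | mul_X p v hp =>
    simp only [Derivation.leibniz, hmul, hadd, smul_eq_mul, hp]
    congr 2
    rcases v with ⟨i, μ⟩ | κ
    · rw [totalDerivation_X_inl, zeroSection_X_inl, zeroSection_X_inl, map_zero]
    · rw [totalDerivation_X_inr, zeroSection_X_inr, totalDerivation_X_inr]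
      split_ifs <;> simp [zeroSection]

theorem zeroSection_zeroSection (f : LocalFn ι n) :
    zeroSection (zeroSection f) = zeroSection f := by
  unfold zeroSection
  rw [← AlgHom.comp_apply, comp_aeval]
  congr 2
  funext v
  rcases v with v | ν <;> simp

theorem zeroSection_sub (f g : LocalFn ι n) :
    zeroSection (f - g) = zeroSection f - zeroSection g :=
  map_sub _ f g

theorem zeroSection_sum {α : Type*} (s : Finset α) (f : α → LocalFn ι n) :
    zeroSection (∑ a ∈ s, f a) = ∑ a ∈ s, zeroSection (f a) :=
  map_sum (aeval _) f s

theorem integral_evalSection_eq_zero (hφ : ∀ i, ContDiff ℝ (⊤ : ℕ∞) (φ i))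
    (hc : ∀ i, HasCompactSupport (φ i)) {f : LocalFn ι n} (hf : zeroSection f = 0)
    (hd : f ∈ totalDivergences ι n) : ∫ x, evalSection φ f x = 0 := by
  obtain ⟨j, rfl⟩ := mem_totalDivergences.1 hd
  have hj : ∀ ν, zeroSection (j ν - zeroSection (j ν)) = 0 := fun ν => by
    rw [zeroSection_sub, zeroSection_zeroSection, sub_self]
  have h : ∑ ν, totalDerivation ν (j ν) = ∑ ν, totalDerivation ν (j ν - zeroSection (j ν)) := by
    simp only [map_sub, Finset.sum_sub_distrib, ← zeroSection_totalDerivation]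
    rw [← zeroSection_sum, hf, sub_zero]
  have hs : evalSection φ (∑ ν, totalDerivation ν (j ν)) =
      fun x => ∑ ν, evalSection φ (totalDerivation ν (j ν - zeroSection (j ν))) x := by
    funext x
    simp only [h, evalSection, map_sum]
  rw [hs, MeasureTheory.integral_finsetSum]
  · exact Finset.sum_eq_zero fun ν _ => integral_evalSection_totalDerivation hφ hc (hj ν) ν
  · intro ν _
    refine integrable_evalSection hφ hc ?_
    rw [zeroSection_totalDerivation, hj, map_zero]

theorem integral_pdm_mul_evalSection (hφ : ∀ i, ContDiff ℝ (⊤ : ℕ∞) (φ i))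
    {η : (Fin n → ℝ) → ℝ} (hη : ContDiff ℝ (⊤ : ℕ∞) η) (hηc : HasCompactSupport η)
    (μ : Multiset (Fin n)) (f : LocalFn ι n) :
    ∫ x, pdm μ η x * evalSection φ f x =
      ∫ x, η x * evalSection φ ((-1 : ℝ) ^ Multiset.card μ • tDm μ f) x := by
  induction μ using Multiset.induction_on generalizing f with
  | empty => simp
  | cons ν μ ih =>
    rw [pdm_cons _ _ hη, integral_pdF_mul ν (contDiff_pdm μ hη) (hasCompactSupport_pdm μ hηc)
      (contDiff_evalSection hφ f), pdF_evalSection hφ, ih, ← MeasureTheory.integral_neg, tDm_cons']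
    refine MeasureTheory.integral_congr_ae (.of_forall fun x => ?_)
    simp [evalSection, pow_succ]

end Sections

section FirstVariation

theorem exists_coeff_one_eq_sum (N : ℕ) : ∃ c : ℕ → ℝ, ∀ P : Polynomial ℝ, P.natDegree ≤ N →
    P.coeff 1 = ∑ m ∈ Finset.range (N + 1), c m * P.eval (m : ℝ) := by
  refine ⟨fun m => (Lagrange.basis (Finset.range (N + 1)) (fun k : ℕ => (k : ℝ)) m).coeff 1,
    fun P hP => ?_⟩
  have hdeg : P.degree < (Finset.range (N + 1)).card := by
    rw [Finset.card_range]
    exact (Polynomial.degree_le_of_natDegree_le hP).trans_lt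
      (by exact_mod_cast Nat.lt_succ_self N)
  have h := Lagrange.eq_interpolate (s := Finset.range (N + 1)) (v := fun k : ℕ => (k : ℝ))
    Nat.cast_injective.injOn hdeg
  conv_lhs => rw [h, Lagrange.interpolate_apply, Polynomial.finsetSum_coeff]
  exact Finset.sum_congr rfl fun m _ => by rw [Polynomial.coeff_C_mul, mul_comm]

/-- The directional derivative of a polynomial is a fixed linear combination of finitely many of
its values along the line. -/
theorem exists_sum_pderiv_eq_sum_eval {σ : Type*} (f : MvPolynomial σ ℝ) :
    ∃ (N : ℕ) (c : ℕ → ℝ), ∀ a w : σ → ℝ, ∑ v ∈ f.vars, w v * eval a (pderiv v f) =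
      ∑ m ∈ Finset.range N, c m * eval (fun v => a v + m * w v) f := by
  obtain ⟨c, hc⟩ := exists_coeff_one_eq_sum (f.totalDegree * 1)
  refine ⟨f.totalDegree * 1 + 1, c, fun a w => ?_⟩
  set u : σ → Polynomial ℝ := fun v => Polynomial.C (a v) + Polynomial.C (w v) * Polynomial.X
  have hu : ∀ v t, (u v).eval t = a v + t * w v := fun v t => by
    rw [mul_comm]
    simp [u]
  have hu' : ∀ v, (Polynomial.derivative (u v)).eval 0 = w v := fun v => by simp [u]
  have heval : ∀ (t : ℝ) (p : MvPolynomial σ ℝ),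
      (aeval u p).eval t = eval (fun v => a v + t * w v) p := by
    intro t p
    induction p using MvPolynomial.induction_on with
    | C r => simp
    | add p q hp hq => simp [hp, hq]
    | mul_X p v hp => simp [hp, hu]
  have hder : ∀ p : MvPolynomial σ ℝ, (Polynomial.derivative (aeval u p)).eval 0 =
      eval a (mkDerivation ℝ (fun v => (C (w v) : MvPolynomial σ ℝ)) p) := by
    intro p
    induction p using MvPolynomial.induction_on with
    | C r => simp
    | add p q hp hq => simp [hp, hq]
    | mul_X p v hp =>
      have h0 := heval 0 p
      simp only [zero_mul, add_zero] at h0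
      simp only [map_mul, aeval_X, Polynomial.derivative_mul, Polynomial.eval_add,
        Polynomial.eval_mul, hp, hu, hu', h0, Derivation.leibniz, mkDerivation_X, smul_eq_mul,
        map_add, eval_X, eval_C]
      ring
  have h1 : (aeval u f).coeff 1 = ∑ v ∈ f.vars, w v * eval a (pderiv v f) := by
    have := hder f
    rw [← Polynomial.coeff_zero_eq_eval_zero, Polynomial.coeff_derivative,
      derivation_eq_sum_vars] at this
    simpa [mkDerivation_X] using this
  rw [← h1, hc _ (aeval_natDegree_le f le_rfl u fun v => ?_)]
  · simp only [heval]
  · exact (Polynomial.natDegree_add_le _ _).trans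
      (max_le (by simp) ((Polynomial.natDegree_C_mul_le _ _).trans Polynomial.natDegree_X_le))

variable {ι : Type} {n : ℕ} [DecidableEq ι] {φ : ι → (Fin n → ℝ) → ℝ}

/-- The jet variables along a variation `η` of the field `i`. -/
noncomputable def jetVariation (i : ι) (η : (Fin n → ℝ) → ℝ) : JetVar ι n → (Fin n → ℝ) → ℝ
  | Sum.inl (j, μ) => if j = i then pdm μ η else 0
  | Sum.inr _ => 0

theorem jetFn_update (hφ : ∀ i, ContDiff ℝ (⊤ : ℕ∞) (φ i)) (i : ι) {η : (Fin n → ℝ) → ℝ}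
    (hη : ContDiff ℝ (⊤ : ℕ∞) η) (t : ℝ) (v : JetVar ι n) (x : Fin n → ℝ) :
    jetFn (Function.update φ i fun y => φ i y + t * η y) v x =
      jetFn φ v x + t * jetVariation i η v x := by
  rcases v with ⟨j, μ⟩ | ν
  · by_cases h : j = i
    · subst h
      simp [jetFn, jetVariation, pdm_add_const_mul μ (hφ j) hη]
    · simp [jetFn, jetVariation, h]
  · simp [jetFn, jetVariation]

theorem integral_sum_jetVariation_mul {f : LocalFn ι n} (hf : zeroSection f = 0)
    (hint : ∀ φ : ι → (Fin n → ℝ) → ℝ, (∀ i, ContDiff ℝ (⊤ : ℕ∞) (φ i)) →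
      (∀ i, HasCompactSupport (φ i)) → ∫ x, evalSection φ f x = 0)
    (hφ : ∀ i, ContDiff ℝ (⊤ : ℕ∞) (φ i)) (hc : ∀ i, HasCompactSupport (φ i)) (i : ι)
    {η : (Fin n → ℝ) → ℝ} (hη : ContDiff ℝ (⊤ : ℕ∞) η) (hηc : HasCompactSupport η) :
    ∫ x, ∑ v ∈ f.vars, jetVariation i η v x * evalSection φ (pderiv v f) x = 0 := by
  obtain ⟨N, c, h⟩ := exists_sum_pderiv_eq_sum_eval f
  set ψ : ℕ → ι → (Fin n → ℝ) → ℝ :=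
    fun m => Function.update φ i fun y => φ i y + m * η y with hψ
  have hψs : ∀ m j, ContDiff ℝ (⊤ : ℕ∞) (ψ m j) := by
    intro m j
    by_cases hj : j = i
    · subst hj
      simpa [hψ] using (hφ j).add (contDiff_const.mul hη)
    · simpa [hψ, hj] using hφ j
  have hψc : ∀ m j, HasCompactSupport (ψ m j) := by
    intro m j
    by_cases hj : j = i
    · subst hj
      simp only [hψ, Function.update_self]
      exact (hc j).add (hηc.mul_left (f := fun _ => (m : ℝ)))
    · simpa [hψ, hj] using hc j
  have hs : ∀ x, ∑ v ∈ f.vars, jetVariation i η v x * evalSection φ (pderiv v f) x =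
      ∑ m ∈ Finset.range N, c m * evalSection (ψ m) f x := by
    intro x
    simp only [evalSection_eq_eval, hψ, jetFn_update hφ i hη]
    exact h _ _
  simp only [hs]
  rw [MeasureTheory.integral_finsetSum _
    fun m _ => (integrable_evalSection (hψs m) (hψc m) hf).const_mul _]
  refine Finset.sum_eq_zero fun m _ => ?_
  rw [MeasureTheory.integral_const_mul, hint _ (hψs m) (hψc m), mul_zero]

theorem integral_mul_evalSection_EL (hφ : ∀ i, ContDiff ℝ (⊤ : ℕ∞) (φ i)) (f : LocalFn ι n)
    (i : ι) {η : (Fin n → ℝ) → ℝ} (hη : ContDiff ℝ (⊤ : ℕ∞) η) (hηc : HasCompactSupport η) :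
    ∫ x, η x * evalSection φ (EL i f) x =
      ∫ x, ∑ v ∈ f.vars, jetVariation i η v x * evalSection φ (pderiv v f) x := by
  have hint : ∀ (θ : (Fin n → ℝ) → ℝ), ContDiff ℝ (⊤ : ℕ∞) θ → HasCompactSupport θ →
      ∀ p : LocalFn ι n, MeasureTheory.Integrable fun x => θ x * evalSection φ p x :=
    fun θ hθ hθc p => (hθ.continuous.mul
      (contDiff_evalSection hφ p).continuous).integrable_of_hasCompactSupport hθc.mul_right
  have hsum : ∀ x (s : Finset (JetVar ι n)) (p : JetVar ι n → LocalFn ι n),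
      η x * evalSection φ (∑ v ∈ s, p v) x = ∑ v ∈ s, η x * evalSection φ (p v) x := by
    intro x s p
    rw [← Finset.mul_sum]
    congr 1
    exact map_sum (eval _) p s
  simp only [EL, hsum]
  rw [MeasureTheory.integral_finsetSum _ fun v _ => hint η hη hηc _,
    MeasureTheory.integral_finsetSum]
  · refine Finset.sum_congr rfl ?_
    rintro (⟨j, μ⟩ | ν) _
    · by_cases h : j = i
      · simp only [h, if_true, jetVariation]
        exact (integral_pdm_mul_evalSection hφ hη hηc μ _).symm
      · simp [h, jetVariation, evalSection]
    · simp [jetVariation, evalSection]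
  · rintro (⟨j, μ⟩ | ν) _
    · by_cases h : j = i
      · simpa [h, jetVariation] using hint _ (contDiff_pdm μ hη) (hasCompactSupport_pdm μ hηc) _
      · simp [h, jetVariation]
    · simp [jetVariation]

/-- If a local functional vanishes on all test configurations, its Euler-Lagrange derivatives
vanish along them. -/
theorem evalSection_EL_eq_zero {f : LocalFn ι n} (hf : zeroSection f = 0)
    (hint : ∀ φ : ι → (Fin n → ℝ) → ℝ, (∀ i, ContDiff ℝ (⊤ : ℕ∞) (φ i)) →
      (∀ i, HasCompactSupport (φ i)) → ∫ x, evalSection φ f x = 0)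
    (hφ : ∀ i, ContDiff ℝ (⊤ : ℕ∞) (φ i)) (hc : ∀ i, HasCompactSupport (φ i)) (i : ι) :
    evalSection φ (EL i f) = 0 := by
  have hcont := (contDiff_evalSection hφ (EL i f)).continuous
  have hae := ae_eq_zero_of_integral_contDiff_smul_eq_zero
    (μ := (MeasureTheory.volume : MeasureTheory.Measure (Fin n → ℝ)))
    hcont.locallyIntegrable fun η hη hηc => by
      simp only [smul_eq_mul]
      rw [integral_mul_evalSection_EL hφ f i hη hηc]
      exact integral_sum_jetVariation_mul hf hint hφ hc i hη hηc
  exact MeasureTheory.Measure.eq_of_ae_eq hae hcont continuous_const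

end FirstVariation

section Jets

variable {n : ℕ}

theorem exists_coeff_foldr_pderiv (l : List (Fin n)) (m : Fin n →₀ ℕ) :
    ∃ c : ℝ, c ≠ 0 ∧ ∀ p : MvPolynomial (Fin n) ℝ,
      coeff m (l.foldr (fun ν q => pderiv ν q) p) =
        c * coeff (m + Multiset.toFinsupp (l : Multiset (Fin n))) p := by
  induction l generalizing m with
  | nil => exact ⟨1, one_ne_zero, fun p => by simp⟩
  | cons ν l ih =>
    obtain ⟨c, hc, h⟩ := ih (m + Finsupp.single ν 1)
    refine ⟨c * (m ν + 1), mul_ne_zero hc (by positivity), fun p => ?_⟩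
    rw [List.foldr_cons, coeff_pderiv, h, ← Multiset.cons_coe, ← Multiset.singleton_add,
      map_add, Multiset.toFinsupp_singleton, add_assoc]
    ring

theorem pdm_eval_sub (x₀ : Fin n → ℝ) (μ : Multiset (Fin n)) (p : MvPolynomial (Fin n) ℝ) :
    pdm μ (fun x => eval (fun ν => x ν - x₀ ν) p) = fun x =>
      eval (fun ν => x ν - x₀ ν) ((μ.sort (· ≤ ·)).foldr (fun ν q => pderiv ν q) p) := by
  unfold pdm
  induction μ.sort (· ≤ ·) with
  | nil => rfl
  | cons ν l ih =>
    rw [List.foldr_cons, ih]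
    refine pdF_eval (u := fun ν x => x ν - x₀ ν)
      (fun κ => (contDiff_apply ℝ ℝ κ).sub contDiff_const) (fun κ x => ?_) _
    have : fderiv ℝ (fun y : Fin n → ℝ => y κ) x = ContinuousLinearMap.proj κ :=
      (ContinuousLinearMap.proj (R := ℝ) (φ := fun _ : Fin n => ℝ) κ).fderiv
    simp only [pdF, fderiv_sub_const, this, ContinuousLinearMap.proj_apply, pderiv_X,
      Pi.single_apply]
    split_ifs <;> simp_all

/-- A test function with finitely many prescribed derivatives at a point. -/
theorem exists_pdm_eq (S : Finset (Multiset (Fin n))) (a : Multiset (Fin n) → ℝ)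
    (x₀ : Fin n → ℝ) : ∃ g : (Fin n → ℝ) → ℝ, ContDiff ℝ (⊤ : ℕ∞) g ∧ HasCompactSupport g ∧
      ∀ μ ∈ S, pdm μ g x₀ = a μ := by
  choose c hc hcoeff using fun μ : Multiset (Fin n) =>
    exists_coeff_foldr_pderiv (μ.sort (· ≤ ·)) 0
  set p : MvPolynomial (Fin n) ℝ := ∑ μ ∈ S, monomial (Multiset.toFinsupp μ) (a μ / c μ) with hp
  set P : (Fin n → ℝ) → ℝ := fun x => eval (fun ν => x ν - x₀ ν) p with hP
  have hPs : ContDiff ℝ (⊤ : ℕ∞) P :=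
    contDiff_eval (u := fun ν x => x ν - x₀ ν)
      (fun κ => (contDiff_apply ℝ ℝ κ).sub contDiff_const) p
  let b : ContDiffBump x₀ := ⟨1, 2, one_pos, one_lt_two⟩
  refine ⟨fun x => b x * P x, b.contDiff.mul hPs, b.hasCompactSupport.mul_right, fun μ hμ => ?_⟩
  have hloc : (fun x => b x * P x) =ᶠ[nhds x₀] P := by
    filter_upwards [b.eventuallyEq_one] with x hx
    simp [hx]
  rw [(pdm_eventuallyEq μ hloc).eq_of_nhds, hP, pdm_eval_sub]
  have h0 : (fun ν => x₀ ν - x₀ ν) = (0 : Fin n → ℝ) := funext fun ν => sub_self _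
  simp only [h0, eval_zero]
  rw [constantCoeff_eq, hcoeff, Multiset.sort_eq, zero_add, hp, coeff_sum,
    Finset.sum_eq_single μ]
  · rw [coeff_monomial, if_pos rfl]
    field_simp [hc μ]
  · intro κ _ hκ
    rw [coeff_monomial, if_neg fun h => hκ (Multiset.toFinsupp.injective h)]
  · exact fun h => absurd hμ h

theorem eq_zero_of_evalSection_eq_zero {ι : Type} {f : LocalFn ι n}
    (h : ∀ φ : ι → (Fin n → ℝ) → ℝ, (∀ i, ContDiff ℝ (⊤ : ℕ∞) (φ i)) →
      (∀ i, HasCompactSupport (φ i)) → evalSection φ f = 0) : f = 0 := by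
  classical
  refine MvPolynomial.funext fun a => ?_
  set S : Finset (Multiset (Fin n)) :=
    f.vars.biUnion (Sum.elim (fun p => {p.2}) fun _ => ∅)
  set x₀ : Fin n → ℝ := fun ν => a (Sum.inr ν)
  choose φ hφ hc hj using fun i => exists_pdm_eq S (fun μ => a (Sum.inl (i, μ))) x₀
  have h0 := congrFun (h φ hφ hc) x₀
  rw [evalSection_eq_eval, Pi.zero_apply] at h0
  rw [map_zero, ← h0]
  refine eval₂Hom_congr' rfl ?_ rfl
  rintro (⟨i, μ⟩ | ν) hv _
  · exact (hj i μ (Finset.mem_biUnion.2 ⟨_, hv, by simp⟩)).symm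
  · rfl

end Jets

/-- two local functionals agree for all (smooth, compactly supported)
field configurations iff their integrands differ by a total divergence, iff the
Euler-Lagrange derivatives of the difference of the integrands vanish. -/
theorem local_functionals_agree_iff {ι : Type} {n : ℕ} [DecidableEq ι]
    (f g : LocalFn ι n) (hf0 : zeroSection f = 0) (hg0 : zeroSection g = 0) :
    ((∀ φ : ι → (Fin n → ℝ) → ℝ, (∀ i, ContDiff ℝ (⊤ : ℕ∞) (φ i)) →
        (∀ i, HasCompactSupport (φ i)) →
        ∫ x : Fin n → ℝ, evalSection φ f x = ∫ x : Fin n → ℝ, evalSection φ g x) ↔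
      (∃ j : Fin n → LocalFn ι n, f = g + ∑ ν : Fin n, tD ν (j ν))) ∧
    ((∃ j : Fin n → LocalFn ι n, f = g + ∑ ν : Fin n, tD ν (j ν)) ↔
      (∀ i : ι, EL i (f - g) = 0)) := by
  have h0 : zeroSection (f - g) = 0 := by rw [zeroSection_sub, hf0, hg0, sub_self]
  have hdiv : (∃ j : Fin n → LocalFn ι n, f = g + ∑ ν : Fin n, tD ν (j ν)) ↔
      f - g ∈ totalDivergences ι n := by
    simp only [mem_totalDivergences, tD_eq_totalDerivation, sub_eq_iff_eq_add']
  have hint : (∀ φ : ι → (Fin n → ℝ) → ℝ, (∀ i, ContDiff ℝ (⊤ : ℕ∞) (φ i)) →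
        (∀ i, HasCompactSupport (φ i)) →
        ∫ x : Fin n → ℝ, evalSection φ f x = ∫ x : Fin n → ℝ, evalSection φ g x) ↔
      ∀ φ : ι → (Fin n → ℝ) → ℝ, (∀ i, ContDiff ℝ (⊤ : ℕ∞) (φ i)) →
        (∀ i, HasCompactSupport (φ i)) → ∫ x, evalSection φ (f - g) x = 0 := by
    refine forall_congr' fun φ => forall_congr' fun hφ => forall_congr' fun hc => ?_
    have hs : ∀ x, evalSection φ (f - g) x = evalSection φ f x - evalSection φ g x :=
      fun x => map_sub _ f g
    simp only [hs]
    rw [MeasureTheory.integral_sub (integrable_evalSection hφ hc hf0)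
      (integrable_evalSection hφ hc hg0), sub_eq_zero]
  rw [hdiv, hint]
  have hEL := fun h i => eq_zero_of_evalSection_eq_zero fun φ hφ hc =>
    evalSection_EL_eq_zero (φ := φ) h0 h hφ hc i
  have hD := mem_totalDivergences_of_EL_eq_zero h0
  have hI := fun h φ hφ hc => integral_evalSection_eq_zero (φ := φ) hφ hc h0 h
  exact ⟨⟨fun h => hD (hEL h), hI⟩, ⟨fun h => hEL (hI h), hD⟩⟩
end

section
/- Noether's second theorem (gauge symmetry ⇒ Noether identity): if Q^i(f) = Q^{i(μ)} ∂_{(μ)} f defines a gauge symmetry, i.e. Q^i(f)·(δL/δφ^i) = ∂_μ j^μ_f for all local functions f, then the formal adjoint operator Q†^i = Σ_{(μ)} (-1)^{|μ|} ∂_{(μ)} ∘ Q^{i(μ)} yields the identically-satisfied Noether identity Q†^i(δL/δφ^i) = 0. -/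
open MvPolynomial

variable {ι : Type} {n : ℕ} [DecidableEq ι]

namespace LocalFn

set_option linter.unusedSectionVars false

noncomputable def totalDerivation (ν : Fin n) :
    Derivation ℝ (LocalFn ι n) (LocalFn ι n) :=
  mkDerivation ℝ (Sum.elim (fun p => X (Sum.inl (p.1, ν ::ₘ p.2))) fun k => if k = ν then 1 else 0)

theorem tD_eq_totalDerivation (ν : Fin n) (f : LocalFn ι n) : tD ν f = totalDerivation ν f := by
  classical
  let D : Derivation ℝ (LocalFn ι n) (LocalFn ι n) :=
    pderiv (Sum.inr ν) + ∑ v ∈ f.vars,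
      (Sum.elim (fun p => X (Sum.inl (p.1, ν ::ₘ p.2))) (fun _ => 0) v : LocalFn ι n) • pderiv v
  have hD (g : LocalFn ι n) : D g = pderiv (Sum.inr ν) g + ∑ v ∈ f.vars,
      (Sum.elim (fun p => X (Sum.inl (p.1, ν ::ₘ p.2))) (fun _ => 0) v : LocalFn ι n) *
        pderiv v g := by
    have hsum := congrArg (fun φ => φ g) (map_sum (Derivation.coeFnAddMonoidHom
      (R := ℝ) (A := LocalFn ι n) (M := LocalFn ι n)) (fun v =>
      (Sum.elim (fun p => X (Sum.inl (p.1, ν ::ₘ p.2))) (fun _ => 0) v : LocalFn ι n) •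
        pderiv v) f.vars)
    simp only [Derivation.coeFnAddMonoidHom, AddMonoidHom.coe_mk, ZeroHom.coe_mk,
      Finset.sum_apply] at hsum
    simp only [D, Derivation.add_apply, hsum, Derivation.smul_apply, smul_eq_mul]
  have h : tD ν f = D f := by
    rw [hD, tD]
    congr 1
    refine Finset.sum_congr rfl fun v _ => ?_
    rcases v with ⟨i, μ⟩ | k <;> simp
  rw [h]
  refine derivation_eq_of_forall_mem_vars fun v hv => ?_
  rw [hD, Finset.sum_eq_single v]
  · rcases v with ⟨i, μ⟩ | k
    · simp [totalDerivation, mkDerivation_X, pderiv_X]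
    · simp [totalDerivation, mkDerivation_X, pderiv_X, Pi.single_apply, eq_comm]
  · intro w _ hw
    rw [pderiv_X_of_ne (Ne.symm hw), mul_zero]
  · exact fun h => absurd hv h

theorem tD_add (ν : Fin n) (f g : LocalFn ι n) : tD ν (f + g) = tD ν f + tD ν g := by
  simp [tD_eq_totalDerivation]

theorem tD_zero (ν : Fin n) : tD ν (0 : LocalFn ι n) = 0 := by
  simp [tD_eq_totalDerivation]

theorem tD_smul (ν : Fin n) (r : ℝ) (f : LocalFn ι n) : tD ν (r • f) = r • tD ν f := by
  simp [tD_eq_totalDerivation]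

theorem tD_mul (ν : Fin n) (f g : LocalFn ι n) : tD ν (f * g) = f * tD ν g + tD ν f * g := by
  simp [tD_eq_totalDerivation, mul_comm]

theorem tD_comm (ν κ : Fin n) (f : LocalFn ι n) : tD ν (tD κ f) = tD κ (tD ν f) := by
  have h : ⁅totalDerivation (ι := ι) ν, totalDerivation (ι := ι) κ⁆ = 0 := by
    refine derivation_ext fun v => ?_
    rcases v with ⟨i, μ⟩ | k
    · simp [Derivation.commutator_apply, totalDerivation, mkDerivation_X, Multiset.cons_swap ν κ]
    · simp only [Derivation.commutator_apply, totalDerivation, mkDerivation_X, Sum.elim_inr]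
      split_ifs <;> simp
  simpa [Derivation.commutator_apply, sub_eq_zero, tD_eq_totalDerivation] using
    congrArg (fun D => D f) h

theorem pderiv_cons_tD (ν : Fin n) (i : ι) (σ : Multiset (Fin n)) (f : LocalFn ι n) :
    pderiv (Sum.inl (i, ν ::ₘ σ)) (tD ν f) =
      tD ν (pderiv (Sum.inl (i, ν ::ₘ σ)) f) + pderiv (Sum.inl (i, σ)) f := by
  have h : ⁅pderiv (R := ℝ) (Sum.inl (i, ν ::ₘ σ) : JetVar ι n), totalDerivation (ι := ι) ν⁆ =
      pderiv (Sum.inl (i, σ)) := by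
    classical
    refine derivation_ext fun v => ?_
    rcases v with ⟨j, μ⟩ | k
    · simp only [Derivation.commutator_apply, totalDerivation, mkDerivation_X, Sum.elim_inl,
        pderiv_X, Pi.single_apply, Sum.inl.injEq, Prod.mk.injEq, Multiset.cons_inj_right]
      split_ifs <;> simp
    · simp only [Derivation.commutator_apply, totalDerivation, mkDerivation_X, Sum.elim_inr,
        pderiv_X, Pi.single_apply, reduceCtorEq, if_false]
      split_ifs <;> simp
  have := congrArg (fun D => D f) h
  simp only [Derivation.commutator_apply, sub_eq_iff_eq_add'] at this
  simpa only [tD_eq_totalDerivation] using this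

theorem pderiv_tD_of_notMem {ν : Fin n} (i : ι) {σ : Multiset (Fin n)} (hν : ν ∉ σ)
    (f : LocalFn ι n) :
    pderiv (Sum.inl (i, σ)) (tD ν f) = tD ν (pderiv (Sum.inl (i, σ)) f) := by
  have h : ⁅pderiv (R := ℝ) (Sum.inl (i, σ) : JetVar ι n), totalDerivation (ι := ι) ν⁆ = 0 := by
    classical
    refine derivation_ext fun v => ?_
    rcases v with ⟨j, μ⟩ | k
    · have : ν ::ₘ μ ≠ σ := fun h => hν (h ▸ Multiset.mem_cons_self ν μ)
      simp only [Derivation.commutator_apply, totalDerivation, mkDerivation_X, Sum.elim_inl,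
        pderiv_X, Pi.single_apply, Sum.inl.injEq, Prod.mk.injEq, this, and_false, if_false]
      split_ifs <;> simp
    · simp only [Derivation.commutator_apply, totalDerivation, mkDerivation_X, Sum.elim_inr,
        pderiv_X, Pi.single_apply, reduceCtorEq, if_false]
      split_ifs <;> simp
  simpa [Derivation.commutator_apply, sub_eq_zero, tD_eq_totalDerivation] using
    congrArg (fun D => D f) h

theorem tDm_zero (f : LocalFn ι n) : tDm 0 f = f := by
  simp [tDm]

theorem tDm_cons (ν : Fin n) (μ : Multiset (Fin n)) (f : LocalFn ι n) :
    tDm (ν ::ₘ μ) f = tD ν (tDm μ f) := by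
  have : LeftCommutative (tD : Fin n → LocalFn ι n → LocalFn ι n) := ⟨tD_comm⟩
  have hp : ((ν ::ₘ μ).sort (· ≤ ·)).Perm (ν :: μ.sort (· ≤ ·)) := by
    rw [← Multiset.coe_eq_coe, ← Multiset.cons_coe, Multiset.sort_eq, Multiset.sort_eq]
  exact hp.foldr_eq f

theorem tDm_tD (μ : Multiset (Fin n)) (ν : Fin n) (f : LocalFn ι n) :
    tDm μ (tD ν f) = tD ν (tDm μ f) := by
  induction μ using Multiset.induction with
  | empty => simp only [tDm_zero]
  | cons κ μ ih => rw [tDm_cons, tDm_cons, ih, tD_comm]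

theorem tDm_add (μ : Multiset (Fin n)) (f g : LocalFn ι n) :
    tDm μ (f + g) = tDm μ f + tDm μ g := by
  induction μ using Multiset.induction with
  | empty => simp only [tDm_zero]
  | cons κ μ ih => simp only [tDm_cons, ih, tD_add]

theorem tDm_fn_zero (μ : Multiset (Fin n)) : tDm μ (0 : LocalFn ι n) = 0 := by
  induction μ using Multiset.induction with
  | empty => rw [tDm_zero]
  | cons κ μ ih => rw [tDm_cons, ih, tD_zero]

/-- The local functions that are total divergences `∂_ν j^ν`. -/
noncomputable def divergences (ι : Type) (n : ℕ) [DecidableEq ι] : AddSubgroup (LocalFn ι n) where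
  carrier := {f | ∃ j : Fin n → LocalFn ι n, f = ∑ ν, tD ν (j ν)}
  zero_mem' := ⟨0, by simp [tD_zero]⟩
  add_mem' := by
    rintro _ _ ⟨j, rfl⟩ ⟨k, rfl⟩
    exact ⟨j + k, by simp [tD_add, Finset.sum_add_distrib]⟩
  neg_mem' := by
    rintro _ ⟨j, rfl⟩
    exact ⟨-j, by simp [tD_eq_totalDerivation]⟩

theorem tD_mem_divergences (ν : Fin n) (f : LocalFn ι n) : tD ν f ∈ divergences ι n := by
  refine ⟨Pi.single ν f, ?_⟩
  rw [Finset.sum_eq_single ν]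
  · simp
  · intro κ _ hκ
    rw [Pi.single_eq_of_ne hκ, tD_zero]
  · simp

/-- Repeated integration by parts. -/
theorem mul_tDm_sub_mem_divergences (μ : Multiset (Fin n)) (f g : LocalFn ι n) :
    f * ((-1 : ℝ) ^ Multiset.card μ • tDm μ g) - tDm μ f * g ∈ divergences ι n := by
  induction μ using Multiset.induction generalizing f with
  | empty => simp [tDm_zero, zero_mem]
  | cons ν μ ih =>
    have h := sub_mem (ih (tD ν f))
      (tD_mem_divergences ν (f * ((-1 : ℝ) ^ Multiset.card μ • tDm μ g)))
    convert h using 1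
    rw [tDm_cons, tDm_cons, tDm_tD, tD_mul, tD_smul, Multiset.card_cons, pow_succ, mul_neg_one,
      neg_smul]
    ring

/-- The Euler–Lagrange derivative as a sum over any finite set of multi-indices that contains
those on which `f` depends. -/
theorem EL_eq_sum (i : ι) (f : LocalFn ι n) (S : Finset (Multiset (Fin n)))
    (hS : ∀ μ ∉ S, pderiv (Sum.inl (i, μ)) f = 0) :
    EL i f = ∑ μ ∈ S, (-1 : ℝ) ^ Multiset.card μ • tDm μ (pderiv (Sum.inl (i, μ)) f) := by
  classical
  let e : Multiset (Fin n) ↪ JetVar ι n :=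
    ⟨fun μ => Sum.inl (i, μ), fun μ κ h => by simpa using h⟩
  let F : JetVar ι n → LocalFn ι n := fun v => match v with
    | Sum.inl (j, μ) =>
        if j = i then ((-1 : ℝ) ^ Multiset.card μ) • tDm μ (pderiv (Sum.inl (j, μ)) f) else 0
    | Sum.inr _ => 0
  have hF (v : JetVar ι n) (hv : pderiv v f = 0) : F v = 0 := by
    rcases v with ⟨j, μ⟩ | k
    · simp [F, hv, tDm_fn_zero]
    · rfl
  have h₁ : EL i f = ∑ v ∈ f.vars ∪ S.map e, F v :=
    Finset.sum_subset Finset.subset_union_left fun v _ hv => hF v (pderiv_eq_zero_of_notMem_vars hv)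
  have h₂ : ∑ v ∈ S.map e, F v = ∑ v ∈ f.vars ∪ S.map e, F v := by
    refine Finset.sum_subset Finset.subset_union_right fun v _ hv => ?_
    rcases v with ⟨j, μ⟩ | k
    · by_cases hj : j = i
      · subst hj
        exact hF _ (hS μ fun hμ => hv (Finset.mem_map_of_mem e hμ))
      · simp [F, hj]
    · rfl
  rw [h₁, ← h₂, Finset.sum_map]
  exact Finset.sum_congr rfl fun μ _ => if_pos rfl

theorem exists_finset_pderiv_eq_zero (i : ι) (f : LocalFn ι n) :
    ∃ S : Finset (Multiset (Fin n)), ∀ μ ∉ S, pderiv (Sum.inl (i, μ)) f = 0 := by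
  classical
  refine ⟨f.vars.image (Sum.elim Prod.snd fun _ => 0), fun μ hμ => ?_⟩
  refine pderiv_eq_zero_of_notMem_vars fun h => hμ ?_
  exact Finset.mem_image.2 ⟨_, h, rfl⟩

theorem EL_add (i : ι) (f g : LocalFn ι n) : EL i (f + g) = EL i f + EL i g := by
  classical
  obtain ⟨S, hS⟩ := exists_finset_pderiv_eq_zero i f
  obtain ⟨T, hT⟩ := exists_finset_pderiv_eq_zero i g
  have hf (μ) (hμ : μ ∉ S ∪ T) : pderiv (Sum.inl (i, μ)) f = 0 :=
    hS μ fun h => hμ (Finset.mem_union_left _ h)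
  have hg (μ) (hμ : μ ∉ S ∪ T) : pderiv (Sum.inl (i, μ)) g = 0 :=
    hT μ fun h => hμ (Finset.mem_union_right _ h)
  rw [EL_eq_sum i f _ hf, EL_eq_sum i g _ hg, EL_eq_sum i (f + g) (S ∪ T), ←
    Finset.sum_add_distrib]
  · simp [tDm_add]
  · intro μ hμ
    rw [map_add, hf μ hμ, hg μ hμ, add_zero]

theorem EL_tD (i : ι) (ν : Fin n) (f : LocalFn ι n) : EL i (tD ν f) = 0 := by
  classical
  obtain ⟨S, hS⟩ := exists_finset_pderiv_eq_zero i f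
  let T := S.image (ν ::ₘ ·)
  let G : Multiset (Fin n) → LocalFn ι n := fun μ =>
    (-1 : ℝ) ^ Multiset.card μ • tDm μ (tD ν (pderiv (Sum.inl (i, μ)) f))
  let H : Multiset (Fin n) → LocalFn ι n := fun μ =>
    (-1 : ℝ) ^ Multiset.card μ •
      tDm μ (pderiv (Sum.inl (i, μ)) (tD ν f) - tD ν (pderiv (Sum.inl (i, μ)) f))
  have hcons (μ) : H (ν ::ₘ μ) = -G μ := by
    simp [H, G, pderiv_cons_tD, tDm_cons, tDm_tD, pow_succ]
  have hH (μ) (hμ : μ ∉ T) : pderiv (Sum.inl (i, μ)) (tD ν f) =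
      tD ν (pderiv (Sum.inl (i, μ)) f) := by
    by_cases h : ν ∈ μ
    · obtain ⟨κ, rfl⟩ := Multiset.exists_cons_of_mem h
      rw [pderiv_cons_tD, hS κ fun hκ => hμ (Finset.mem_image_of_mem _ hκ), add_zero]
    · exact pderiv_tD_of_notMem i h f
  have hsplit : EL i (tD ν f) = ∑ μ ∈ S ∪ T, (G μ + H μ) := by
    rw [EL_eq_sum i _ (S ∪ T)]
    · refine Finset.sum_congr rfl fun μ _ => ?_
      rw [← smul_add, ← tDm_add, add_sub_cancel]
    · intro μ hμ
      rw [Finset.mem_union, not_or] at hμ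
      rw [hH μ hμ.2, hS μ hμ.1, tD_zero]
  have hG : ∑ μ ∈ S ∪ T, G μ = ∑ μ ∈ S, G μ := by
    refine (Finset.sum_subset Finset.subset_union_left fun μ _ hμ => ?_).symm
    simp [G, hS μ hμ, tD_zero, tDm_fn_zero]
  have hHsum : ∑ μ ∈ S ∪ T, H μ = ∑ μ ∈ T, H μ := by
    refine (Finset.sum_subset Finset.subset_union_right fun μ _ hμ => ?_).symm
    simp [H, hH μ hμ, tDm_fn_zero]
  rw [hsplit, Finset.sum_add_distrib, hG, hHsum,
    Finset.sum_image fun _ _ _ _ h => (Multiset.cons_inj_right ν).1 h]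
  simp [hcons]

theorem EL_eq_zero_of_mem_divergences (i : ι) {f : LocalFn ι n} (hf : f ∈ divergences ι n) :
    EL i f = 0 := by
  obtain ⟨j, rfl⟩ := hf
  refine (map_sum (AddMonoidHom.mk' (EL i) (EL_add (n := n) i)) _ _).trans ?_
  exact Finset.sum_eq_zero fun ν _ => EL_tD i ν (j ν)

/-- `f` does not depend on the derivatives of `φ^i` of order greater than `k`. -/
def OrderLE (i : ι) (k : ℕ) (f : LocalFn ι n) : Prop :=
  ∀ σ : Multiset (Fin n), k < Multiset.card σ → pderiv (Sum.inl (i, σ)) f = 0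

theorem exists_orderLE (i : ι) (f : LocalFn ι n) : ∃ k, OrderLE i k f := by
  obtain ⟨S, hS⟩ := exists_finset_pderiv_eq_zero i f
  refine ⟨S.sup Multiset.card, fun σ hσ => hS σ fun h => ?_⟩
  exact absurd (Finset.le_sup (f := Multiset.card) h) (not_le.2 hσ)

theorem pderiv_comm (v w : JetVar ι n) (f : LocalFn ι n) :
    pderiv v (pderiv w f) = pderiv w (pderiv v f) := by
  classical
  have h : ⁅pderiv (R := ℝ) v, pderiv (R := ℝ) w⁆ = 0 := by
    refine derivation_ext fun u => ?_
    simp only [Derivation.commutator_apply, pderiv_X, Pi.single_apply]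
    split_ifs <;> simp
  simpa [Derivation.commutator_apply, sub_eq_zero] using congrArg (fun D => D f) h

theorem OrderLE.pderiv {i : ι} {k : ℕ} {f : LocalFn ι n} (hf : OrderLE i k f) (v : JetVar ι n) :
    OrderLE i k (pderiv v f) := fun σ hσ => by
  rw [pderiv_comm, hf σ hσ, map_zero]

theorem OrderLE.mono {i : ι} {k l : ℕ} {f : LocalFn ι n} (hf : OrderLE i k f) (h : k ≤ l) :
    OrderLE i l f := fun σ hσ => hf σ (h.trans_lt hσ)

theorem OrderLE.mul {i : ι} {k : ℕ} {f g : LocalFn ι n} (hf : OrderLE i k f)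
    (hg : OrderLE i k g) : OrderLE i k (f * g) := fun σ hσ => by
  rw [Derivation.leibniz, hf σ hσ, hg σ hσ, smul_zero, smul_zero, add_zero]

theorem orderLE_X (i : ι) (σ : Multiset (Fin n)) :
    OrderLE i (Multiset.card σ) (X (Sum.inl (i, σ)) : LocalFn ι n) := fun τ hτ => by
  refine pderiv_X_of_ne fun h => ?_
  simp only [Sum.inl.injEq, Prod.mk.injEq, true_and] at h
  exact hτ.ne (congrArg _ h)

theorem OrderLE.tD {i : ι} {k : ℕ} {f : LocalFn ι n} (hf : OrderLE i k f) (ν : Fin n) :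
    OrderLE i (k + 1) (tD ν f) := fun σ hσ => by
  by_cases h : ν ∈ σ
  · obtain ⟨κ, rfl⟩ := Multiset.exists_cons_of_mem h
    rw [Multiset.card_cons] at hσ
    rw [pderiv_cons_tD, hf _ (by rw [Multiset.card_cons]; omega), hf κ (by omega), tD_zero,
      add_zero]
  · rw [pderiv_tD_of_notMem i h, hf σ (by omega), tD_zero]

theorem OrderLE.tDm {i : ι} {k : ℕ} {f : LocalFn ι n} (hf : OrderLE i k f)
    (μ : Multiset (Fin n)) : OrderLE i (k + Multiset.card μ) (tDm μ f) := by
  induction μ using Multiset.induction with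
  | empty => simpa [tDm_zero] using hf
  | cons ν μ ih =>
    rw [tDm_cons, Multiset.card_cons, ← add_assoc]
    exact ih.tD ν

/-- The leading coefficient of `∂_{(μ)} f` is that of `f`. -/
theorem OrderLE.pderiv_add_tDm {i : ι} {k : ℕ} {f : LocalFn ι n} (hf : OrderLE i k f)
    {σ : Multiset (Fin n)} (hσ : Multiset.card σ = k) (μ : Multiset (Fin n)) :
    MvPolynomial.pderiv (Sum.inl (i, μ + σ)) (_root_.tDm μ f) =
      MvPolynomial.pderiv (Sum.inl (i, σ)) f := by
  induction μ using Multiset.induction with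
  | empty => rw [zero_add, tDm_zero]
  | cons ν μ ih =>
    rw [Multiset.cons_add, tDm_cons, pderiv_cons_tD, ih, hf.tDm μ _ ?_, tD_zero, zero_add]
    rw [Multiset.card_cons, Multiset.card_add]
    omega

/-- A local function all of whose multiples are total divergences vanishes. -/
theorem eq_zero_of_forall_mul_mem_divergences (i : ι) (N : LocalFn ι n)
    (hN : ∀ f, f * N ∈ divergences ι n) : N = 0 := by
  classical
  rcases Nat.eq_zero_or_pos n with rfl | hn
  · obtain ⟨j, hj⟩ := hN 1
    simpa using hj
  obtain ⟨m, hm⟩ := exists_orderLE i N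
  let ρ : Multiset (Fin n) := Multiset.replicate (m + 1) ⟨0, hn⟩
  have hρ : Multiset.card ρ = m + 1 := Multiset.card_replicate _ _
  let u : LocalFn ι n := X (Sum.inl (i, ρ))
  have hu : OrderLE i (m + 1) u := hρ ▸ orderLE_X i ρ
  have hself : pderiv (Sum.inl (i, ρ)) (u * u * N) = (2 : ℝ) • (u * N) := by
    rw [Derivation.leibniz, hm ρ (by omega), Derivation.leibniz, pderiv_X_self,
      Algebra.smul_def (2 : ℝ), map_ofNat]
    simp only [smul_eq_mul]
    ring
  have hother (μ) (hμ : μ ≠ ρ) :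
      pderiv (Sum.inl (i, μ)) (u * u * N) = u * u * pderiv (Sum.inl (i, μ)) N := by
    have : pderiv (Sum.inl (i, μ)) u = 0 := pderiv_X_of_ne fun h => hμ (by simpa using h.symm)
    simp [Derivation.leibniz, this]
  obtain ⟨S, hS⟩ := exists_finset_pderiv_eq_zero i (u * u * N)
  have hEL := EL_eq_zero_of_mem_divergences i (hN (u * u))
  rw [EL_eq_sum i _ (insert ρ S) fun μ hμ => hS μ fun h => hμ (Finset.mem_insert_of_mem h)] at hEL
  have hlead := congrArg (pderiv (Sum.inl (i, ρ + ρ))) hEL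
  rw [map_sum, map_zero, Finset.sum_eq_single ρ] at hlead
  · have huN : OrderLE i (m + 1) ((2 : ℝ) • (u * N)) := by
      rw [← hself]
      exact ((hu.mul hu).mul (hm.mono (Nat.le_succ m))).pderiv _
    rw [Derivation.map_smul, hself, huN.pderiv_add_tDm hρ, Derivation.map_smul,
      Derivation.leibniz, hm ρ (by omega), pderiv_X_self] at hlead
    simpa using hlead
  · intro μ _ hμ
    rw [hother μ hμ, Derivation.map_smul]
    by_cases hμm : m < Multiset.card μ
    · rw [hm μ hμm, mul_zero, tDm_fn_zero, map_zero, smul_zero]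
    · rw [((hu.mul hu).mul ((hm.mono (Nat.le_succ m)).pderiv _)).tDm μ, smul_zero]
      rw [Multiset.card_add]
      omega
  · exact fun h => absurd (Finset.mem_insert_self ρ S) h

end LocalFn

/-- Noether's second theorem, gauge symmetry ⇒ Noether identity:
if Q^i(f) = Q^{i(μ)}∂_{(μ)}f satisfies Q^i(f)·δL/δφ^i = ∂_μ j^μ_f for every local
function f, then the Noether identity Q†^i(δL/δφ^i) =
Σ_{(μ)} (−1)^{|μ|} ∂_{(μ)}(Q^{i(μ)} δL/δφ^i) = 0 holds identically. -/
theorem noether_second_theorem {ι : Type} {n : ℕ} [DecidableEq ι] [Fintype ι]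
    (L : LocalFn ι n)
    (Q : ι → (Multiset (Fin n) →₀ LocalFn ι n))
    (hgauge : ∀ f : LocalFn ι n, ∃ j : Fin n → LocalFn ι n,
      (∑ i : ι, (Q i).sum fun μ c => c * tDm μ f * EL i L) =
        ∑ ν : Fin n, tD ν (j ν)) :
    (∑ i : ι, (Q i).sum fun μ c =>
        ((-1 : ℝ) ^ Multiset.card μ) • tDm μ (c * EL i L)) = 0 := by
  rcases isEmpty_or_nonempty ι with _ | ⟨⟨i₀⟩⟩
  · simp
  refine LocalFn.eq_zero_of_forall_mul_mem_divergences i₀ _ fun f => ?_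
  have hf : (∑ i : ι, (Q i).sum fun μ c => c * tDm μ f * EL i L) ∈ LocalFn.divergences ι n :=
    hgauge f
  rw [← sub_add_cancel (f * _) (∑ i : ι, (Q i).sum fun μ c => c * tDm μ f * EL i L)]
  refine add_mem ?_ hf
  simp only [Finsupp.sum, Finset.mul_sum, ← Finset.sum_sub_distrib]
  refine sum_mem fun i _ => sum_mem fun μ _ => ?_
  convert LocalFn.mul_tDm_sub_mem_divergences μ f (Q i μ * EL i L) using 2
  ring
end
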